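/- Let α : G → Aut(A) be an action of a finite group G on a simple C*-algebra A. Suppose that for every finite subset F ⊆ A, every ε > 0, and all positive x, y ∈ A with ‖x‖ = 1, there exists a family (p_g)_{g∈G} of self-adjoint elements of A with ‖p_g² − p_g‖ < ε for all g ∈ G and ‖p_g p_h‖ < ε for all g ≠ h in G, such that, with p = Σ_{g∈G} p_g: (1) ‖p_g a − a p_g‖ < ε for all a ∈ F and g ∈ G; (2) ‖α_g(p_h) − p_{gh}‖ < ε for all g, h ∈ G; (3) (y² − y p y − ε)₊ ≾ x in A; (4) ‖p x p‖ > 1 − ε. Then α has the tracial Rokhlin property; conversely, the tracial Rokhlin property implies this condition. -/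

import Mathlib

open Filter Topology

/-- Cuntz subequivalence `a ≾ b` in a C*-algebra. -/
def CuntzSubeq {A : Type*} [NonUnitalCStarAlgebra A] (a b : A) : Prop :=
  ∃ v : ℕ → A, Tendsto (fun n => ‖a - v n * b * star (v n)‖) atTop (nhds 0)

/-- A projection in a C*-algebra: a self-adjoint idempotent. -/
def IsProjection {A : Type*} [NonUnitalCStarAlgebra A] (p : A) : Prop :=
  IsSelfAdjoint p ∧ p * p = p

/-- A C*-algebra is simple if it is nonzero and its only closed two-sided ideals
are `⊥` and `⊤`. -/
def IsSimpleCStarAlgebra (A : Type*) [NonUnitalCStarAlgebra A] : Prop :=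
  (∃ a : A, a ≠ 0) ∧ ∀ I : TwoSidedIdeal A, IsClosed (I : Set A) → I = ⊥ ∨ I = ⊤

/-- `(c - ε)₊`, via the (non-unital) continuous functional calculus. -/
noncomputable def cutPos {A : Type*} [NonUnitalCStarAlgebra A] (c : A) (ε : ℝ) : A :=
  cfcₙ (fun t : ℝ => max (t - ε) 0) c

/-- The tracial Rokhlin property for an action of a finite group `G` on a C*-algebra `A`. -/
def TracialRokhlinProperty {A : Type*} [NonUnitalCStarAlgebra A] [PartialOrder A]
    [StarOrderedRing A] {G : Type*} [Group G] [Fintype G]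
    (α : G → A ≃⋆ₐ[ℂ] A) : Prop :=
  ∀ (F : Finset A) (ε : ℝ), 0 < ε → ∀ x y : A, 0 ≤ x → 0 ≤ y → ‖x‖ = 1 →
    ∃ p : G → A,
      (∀ g, IsProjection (p g)) ∧
      (∀ g h, g ≠ h → p g * p h = 0) ∧
      (∀ a ∈ F, ∀ g, ‖p g * a - a * p g‖ < ε) ∧
      (∀ g h, ‖α g (p h) - p (g * h)‖ < ε) ∧
      CuntzSubeq (cutPos (y * y - y * (∑ g, p g) * y) ε) x ∧
      ‖(∑ g, p g) * x * (∑ g, p g)‖ > 1 - ε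


section ScalarFunctions

/-- A continuous function equal to `0` below `1 / 4` and to `1` above `3 / 4`, together with
a continuous quotient of it by the identity. -/
lemma exists_continuous_cutoff :
    ∃ χ k : ℝ → ℝ, Continuous χ ∧ Continuous k ∧ χ 0 = 0 ∧ k 0 = 0 ∧
      (∀ t ≤ 1 / 4, χ t = 0) ∧ (∀ t, 3 / 4 ≤ t → χ t = 1) ∧ ∀ t, χ t = t * k t := by
  let χ : ℝ → ℝ := fun t => max 0 (min 1 (2 * t - 1 / 2))
  have low (t : ℝ) (ht : t ≤ 1 / 4) : χ t = 0 :=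
    max_eq_left ((min_le_right _ _).trans (by linarith))
  have high (t : ℝ) (ht : 3 / 4 ≤ t) : χ t = 1 := by
    simp only [χ]
    rw [min_eq_left (by linarith), max_eq_right zero_le_one]
  have hχ : Continuous χ := by fun_prop
  have hχ0 : χ 0 = 0 := low 0 (by norm_num)
  refine ⟨χ, fun t => χ t / max t (1 / 4), hχ, hχ.div (by fun_prop) fun t => ?_, hχ0,
    by simp [hχ0], low, high, fun t => ?_⟩
  · exact (lt_max_of_lt_right (by norm_num)).ne'
  · rcases le_total t (1 / 4) with ht | ht
    · simp [low t ht]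
    · simp only [max_eq_left ht]
      field_simp

lemma exists_continuous_approx_inv_sqrt {τ : ℝ} (hτ : 0 < τ) :
    ∃ f : ℝ → ℝ, Continuous f ∧ f 0 = 0 ∧ ∀ t, 0 ≤ t →
      0 ≤ f t * t * f t ∧ f t * t * f t ≤ 1 ∧ t * (1 - f t * t * f t) ≤ 2 * τ := by
  refine ⟨fun t => √t / (|t| + τ), Real.continuous_sqrt.div (by fun_prop)
    fun t => by positivity, by simp, fun t ht => ?_⟩
  have hu : √t / (|t| + τ) * t * (√t / (|t| + τ)) = t ^ 2 / (t + τ) ^ 2 := by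
    rw [abs_of_nonneg ht, show √t / (t + τ) * t * (√t / (t + τ))
      = (√t * √t) * t / ((t + τ) * (t + τ)) by rw [div_mul_eq_mul_div, div_mul_div_comm]; ring,
      Real.mul_self_sqrt ht, sq, sq]
  have hpos : 0 < t + τ := by positivity
  simp only [hu]
  refine ⟨by positivity, ?_, ?_⟩
  · rw [div_le_one (by positivity)]
    nlinarith
  · have : t * (1 - t ^ 2 / (t + τ) ^ 2) = t * (τ * (2 * t + τ)) / (t + τ) ^ 2 := by
      field_simp
      ring
    rw [this, div_le_iff₀ (by positivity)]
    nlinarith [mul_nonneg ht hτ.le, mul_nonneg (mul_nonneg ht hτ.le) hτ.le, pow_pos hτ 3]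

end ScalarFunctions

section AlmostProjections

variable {A : Type*} [NonUnitalCStarAlgebra A]

lemma IsProjection.norm_le_one {p : A} (hp : IsProjection p) : ‖p‖ ≤ 1 := by
  have h := hp.1.norm_mul_self
  rw [hp.2] at h
  nlinarith [norm_nonneg p]

lemma IsProjection.sum {ι : Type*} {s : Finset ι} {p : ι → A}
    (hp : ∀ i ∈ s, IsProjection (p i)) (horth : ∀ i ∈ s, ∀ j ∈ s, i ≠ j → p i * p j = 0) :
    IsProjection (∑ i ∈ s, p i) := by
  refine ⟨isSelfAdjoint_sum s fun i hi => (hp i hi).1, ?_⟩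
  rw [Finset.sum_mul_sum]
  refine Finset.sum_congr rfl fun i hi => ?_
  rw [Finset.sum_eq_single_of_mem i hi fun j hj hji => horth i hi j hj hji.symm, (hp i hi).2]

/-- An almost projection is close to a projection with the same left annihilators. -/
lemma exists_isProjection_near {q : A} (hq : IsSelfAdjoint q) {δ : ℝ} (hδ : δ ≤ 1 / 8)
    (h : ‖q * q - q‖ ≤ δ) :
    ∃ p : A, IsProjection p ∧ ‖p - q‖ ≤ 2 * δ ∧ ∀ z : A, z * q = 0 → z * p = 0 := by
  obtain ⟨χ, k, hχ, hk, hχ0, hk0, low, high, hfac⟩ := exists_continuous_cutoff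
  have hspec {t : ℝ} (ht : t ∈ quasispectrum ℝ q) : |t * t - t| ≤ δ := by
    have e : cfcₙ (fun t : ℝ => t * t - t) q = q * q - q := by
      rw [cfcₙ_sub _ _ q, cfcₙ_mul _ _ q, cfcₙ_id' ℝ q]
    have := norm_apply_le_norm_cfcₙ (fun t : ℝ => t * t - t) q ht
    rw [e] at this
    exact this.trans h
  have hgap {t : ℝ} (ht : |t * t - t| ≤ δ) : t ≤ 1 / 4 ∨ 3 / 4 ≤ t := by
    by_contra! hc
    have := (abs_le.mp ht).1
    nlinarith
  refine ⟨cfcₙ χ q, ⟨cfcₙ_predicate _ _, ?_⟩, ?_, fun z hz => ?_⟩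
  · rw [← cfcₙ_mul χ χ q]
    refine cfcₙ_congr fun t ht => ?_
    rcases hgap (hspec ht) with h' | h'
    · simp [low t h']
    · simp [high t h']
  · have e : cfcₙ χ q - q = cfcₙ (fun t : ℝ => χ t - t) q := by
      rw [cfcₙ_sub _ _ q, cfcₙ_id' ℝ q]
    rw [e]
    refine norm_cfcₙ_le fun t ht => ?_
    have h1 := hspec ht
    have h2 := abs_le.mp h1
    rw [Real.norm_eq_abs, abs_le]
    rcases hgap h1 with h' | h'
    · rw [low t h']
      constructor <;> nlinarith
    · rw [high t h']
      constructor <;> nlinarith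
  · have e : cfcₙ χ q = q * cfcₙ k q := by
      rw [show χ = fun t => t * k t from funext hfac, cfcₙ_mul _ _ q, cfcₙ_id' ℝ q]
    rw [e, ← mul_assoc, hz, zero_mul]

lemma norm_le_two_of_almost_idempotent {q : A} (hq : IsSelfAdjoint q)
    (h : ‖q * q - q‖ ≤ 1) : ‖q‖ ≤ 2 := by
  have h1 := hq.norm_mul_self
  have h2 : ‖q * q‖ ≤ ‖q * q - q‖ + ‖q‖ := by
    simpa using norm_add_le (q * q - q) q
  nlinarith [norm_nonneg q]

lemma exists_isProjection_near_orthogonal {P q : A} (hP : IsProjection P)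
    (hq : IsSelfAdjoint q) {δ τ : ℝ} (h : ‖q * q - q‖ ≤ δ) (hPq : ‖P * q‖ ≤ τ)
    (hδτ : δ + 18 * τ ≤ 1 / 8) :
    ∃ p : A, IsProjection p ∧ P * p = 0 ∧ ‖p - q‖ ≤ 2 * δ + 39 * τ := by
  have hτ := (norm_nonneg _).trans hPq
  have hδ := (norm_nonneg _).trans h
  have hq2 := norm_le_two_of_almost_idempotent hq (by linarith)
  have hqP : ‖q * P‖ ≤ τ := by
    rw [← norm_star, star_mul, hq.star_eq, hP.1.star_eq]
    exact hPq
  let r := q - P * q - q * P + P * q * P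
  have hr : IsSelfAdjoint r := by
    simp only [IsSelfAdjoint, r, star_add, star_sub, star_mul, hq.star_eq, hP.1.star_eq, mul_assoc]
    abel
  have hPr : P * r = 0 := by
    simp only [r, mul_add, mul_sub, ← mul_assoc, hP.2]
    abel
  have hrq : ‖r - q‖ ≤ 3 * τ := by
    have e : r - q = P * q * P - P * q - q * P := by simp only [r]; abel
    have h1 : ‖P * q * P‖ ≤ τ :=
      (norm_mul_le _ _).trans ((mul_le_of_le_one_right (norm_nonneg _) hP.norm_le_one).trans hPq)
    rw [e]
    linarith [norm_sub_le (P * q * P - P * q) (q * P), norm_sub_le (P * q * P) (P * q)]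
  have hr2 : ‖r‖ ≤ 3 := by
    have : ‖r‖ ≤ ‖r - q‖ + ‖q‖ := by simpa using norm_add_le (r - q) q
    linarith
  have hrr : ‖r * r - r‖ ≤ δ + 18 * τ := by
    have e : r * r - r = (r * (r - q) + (r - q) * q) + ((q * q - q) - (r - q)) := by
      noncomm_ring
    rw [e]
    have h1 := norm_add_le (r * (r - q) + (r - q) * q) ((q * q - q) - (r - q))
    have h2 := norm_add_le (r * (r - q)) ((r - q) * q)
    have h3 := norm_sub_le (q * q - q) (r - q)
    have h4 : ‖r * (r - q)‖ ≤ 3 * (3 * τ) := norm_mul_le_of_le hr2 hrq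
    have h5 : ‖(r - q) * q‖ ≤ 3 * τ * 2 := norm_mul_le_of_le hrq hq2
    linarith
  obtain ⟨p, hp, hpr, hz⟩ := exists_isProjection_near hr hδτ hrr
  refine ⟨p, hp, hz P hPr, ?_⟩
  have : ‖p - q‖ ≤ ‖p - r‖ + ‖r - q‖ := norm_sub_le_norm_sub_add_norm_sub _ _ _
  linarith

/-- Almost orthogonal self-adjoint almost projections are close to orthogonal projections. -/
lemma exists_orthogonal_projections_near (A : Type*) [NonUnitalCStarAlgebra A] {ι : Type*}
    (s : Finset ι) {η : ℝ} (hη : 0 < η) :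
    ∃ δ > 0, ∀ q : ι → A, (∀ i, IsSelfAdjoint (q i)) → (∀ i, ‖q i * q i - q i‖ ≤ δ) →
      (∀ i j, i ≠ j → ‖q i * q j‖ ≤ δ) →
      ∃ p : ι → A, (∀ i ∈ s, IsProjection (p i)) ∧ (∀ i ∈ s, ‖p i - q i‖ ≤ η) ∧
        ∀ i ∈ s, ∀ j ∈ s, i ≠ j → p i * p j = 0 := by
  classical
  induction s using Finset.induction_on generalizing η with
  | empty => exact ⟨1, one_pos, fun q _ _ _ => ⟨q, by simp⟩⟩
  | insert i s his ih =>
    let n : ℝ := s.card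
    have hn : 0 ≤ n := Nat.cast_nonneg _
    let κ := min η (1 / 8) / (200 * (n + 1))
    have hκ : 0 < κ := by positivity
    have hκe : κ * (200 * (n + 1)) = min η (1 / 8) := div_mul_cancel₀ _ (by positivity)
    have hκη : κ * (200 * (n + 1)) ≤ η := hκe.trans_le (min_le_left _ _)
    have hκ8 : κ * (200 * (n + 1)) ≤ 1 / 8 := hκe.trans_le (min_le_right _ _)
    have hnκ : 0 ≤ n * κ := by positivity
    obtain ⟨δ, hδ, H⟩ := ih hκ
    refine ⟨min δ κ, lt_min hδ hκ, fun q hq hqq hqo => ?_⟩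
    obtain ⟨p, hp, hpq, hpo⟩ := H q hq (fun j => (hqq j).trans (min_le_left _ _))
      fun j l hjl => (hqo j l hjl).trans (min_le_left _ _)
    have hqi : ‖q i * q i - q i‖ ≤ κ := (hqq i).trans (min_le_right _ _)
    have hqi2 := norm_le_two_of_almost_idempotent (hq i) (by nlinarith)
    have hPq : ‖(∑ j ∈ s, p j) * q i‖ ≤ 3 * (n * κ) := by
      rw [Finset.sum_mul]
      refine (norm_sum_le_of_le (n := fun _ => 3 * κ) s fun j hj => ?_).trans
        (by simp only [Finset.sum_const, nsmul_eq_mul, n]; linarith)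
      have e : p j * q i = (p j - q j) * q i + q j * q i := by noncomm_ring
      have hji : j ≠ i := fun h => his (h ▸ hj)
      rw [e]
      have h1 : ‖(p j - q j) * q i‖ ≤ κ * 2 := norm_mul_le_of_le (hpq j hj) hqi2
      have h2 : ‖q j * q i‖ ≤ κ := (hqo j i hji).trans (min_le_right _ _)
      linarith [norm_add_le ((p j - q j) * q i) (q j * q i)]
    obtain ⟨r, hr, hPr, hrq⟩ := exists_isProjection_near_orthogonal (IsProjection.sum hp hpo)
      (hq i) hqi hPq (by linarith)
    have hpr {j : ι} (hj : j ∈ s) : p j * r = 0 := by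
      have e : p j * ∑ l ∈ s, p l = p j := by
        rw [Finset.mul_sum, Finset.sum_eq_single_of_mem j hj
          fun l hl hlj => hpo j hj l hl hlj.symm, (hp j hj).2]
      rw [← e, mul_assoc, hPr, mul_zero]
    have hrp {j : ι} (hj : j ∈ s) : r * p j = 0 := by
      have := congrArg star (hpr hj)
      rwa [star_mul, hr.1.star_eq, (hp j hj).1.star_eq, star_zero] at this
    have hne {j : ι} (hj : j ∈ s) : j ≠ i := fun h => his (h ▸ hj)
    refine ⟨Function.update p i r, fun j hj => ?_, fun j hj => ?_, fun j hj l hl hjl => ?_⟩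
    · rcases Finset.mem_insert.mp hj with rfl | hj
      · simpa using hr
      · simpa [hne hj] using hp j hj
    · rcases Finset.mem_insert.mp hj with rfl | hj
      · simp only [Function.update_self]
        linarith
      · simp only [ne_eq, hne hj, not_false_eq_true, Function.update_of_ne]
        nlinarith [hpq j hj]
    · rcases Finset.mem_insert.mp hj with hji | hjs <;>
        rcases Finset.mem_insert.mp hl with hli | hls
      · exact absurd (hji.trans hli.symm) hjl
      · subst hji
        simpa [hne hls] using hrp hls
      · subst hli
        simpa [hne hjs] using hpr hjs
      · simpa [hne hjs, hne hls] using hpo j hjs l hls hjl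

end AlmostProjections

section Cuntz

variable {A : Type*} [NonUnitalCStarAlgebra A]

lemma cuntzSubeq_iff_forall_exists {a b : A} :
    CuntzSubeq a b ↔ ∀ ε : ℝ, 0 < ε → ∃ v : A, ‖a - v * b * star v‖ ≤ ε := by
  constructor
  · rintro ⟨v, hv⟩ ε hε
    obtain ⟨n, hn⟩ := (hv.eventually_le_const hε).exists
    exact ⟨v n, hn⟩
  · intro h
    choose v hv using fun n : ℕ => h (1 / ((n : ℝ) + 1)) (by positivity)
    exact ⟨v, squeeze_zero (fun _ => norm_nonneg _) hv tendsto_one_div_add_atTop_nhds_zero_nat⟩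

lemma CuntzSubeq.trans {a b c : A} (hab : CuntzSubeq a b) (hbc : CuntzSubeq b c) :
    CuntzSubeq a c := by
  rw [cuntzSubeq_iff_forall_exists] at *
  intro ε hε
  obtain ⟨v, hv⟩ := hab (ε / 2) (by positivity)
  have hV : 0 < ‖v‖ * ‖v‖ + 1 := by positivity
  obtain ⟨w, hw⟩ := hbc (ε / 2 / (‖v‖ * ‖v‖ + 1)) (by positivity)
  refine ⟨v * w, ?_⟩
  have e : a - v * w * c * star (v * w)
      = (a - v * b * star v) + v * (b - w * c * star w) * star v := by
    rw [star_mul]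
    noncomm_ring
  have h1 : ‖v * (b - w * c * star w) * star v‖ ≤ ‖v‖ * (ε / 2 / (‖v‖ * ‖v‖ + 1)) * ‖v‖ :=
    norm_mul_le_of_le (norm_mul_le_of_le le_rfl hw) (norm_star v).le
  have h2 : ‖v‖ * (ε / 2 / (‖v‖ * ‖v‖ + 1)) * ‖v‖ ≤ ε / 2 := by
    rw [show ‖v‖ * (ε / 2 / (‖v‖ * ‖v‖ + 1)) * ‖v‖
      = (ε / 2) * (‖v‖ * ‖v‖) / (‖v‖ * ‖v‖ + 1) by ring, div_le_iff₀ hV]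
    nlinarith
  rw [e]
  exact (norm_add_le _ _).trans (by linarith)

variable [PartialOrder A] [StarOrderedRing A]

/-- Conjugation by the self-adjoint element `1 - h` of the unitization
preserves the order, written inside `A`. -/
lemma sub_mul_compression_le {x y h : A} (hxy : x ≤ y) (hh : IsSelfAdjoint h) :
    x - h * x - x * h + h * x * h ≤ y - h * y - y * h + h * y * h := by
  have hw : 0 ≤ y - x := sub_nonneg.mpr hxy
  obtain ⟨s, hs, hss⟩ : ∃ s : A, IsSelfAdjoint s ∧ s * s = y - x :=
    ⟨CFC.sqrt (y - x), (CFC.sqrt_nonneg _).isSelfAdjoint, CFC.sqrt_mul_sqrt_self _ hw⟩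
  rw [← sub_nonneg]
  have e : y - h * y - y * h + h * y * h - (x - h * x - x * h + h * x * h)
      = star (s - s * h) * (s - s * h) := by
    rw [star_sub, star_mul, hs.star_eq, hh.star_eq]
    have : (s - h * s) * (s - s * h) = s * s - h * (s * s) - s * s * h + h * (s * s) * h := by
      noncomm_ring
    rw [this, hss]
    noncomm_ring
  rw [e]
  exact star_mul_self_nonneg _

lemma cuntzSubeq_of_le {x y : A} (hx : 0 ≤ x) (hxy : x ≤ y) : CuntzSubeq x y := by
  have hy : 0 ≤ y := hx.trans hxy
  obtain ⟨r, hr, hrr⟩ : ∃ r : A, IsSelfAdjoint r ∧ r * r = x :=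
    ⟨CFC.sqrt x, (CFC.sqrt_nonneg _).isSelfAdjoint, CFC.sqrt_mul_sqrt_self _ hx⟩
  rw [cuntzSubeq_iff_forall_exists]
  intro ε hε
  let σ := ε / (‖r‖ + 1)
  have hσ : 0 < σ := by positivity
  let τ := σ ^ 2 / 2
  have hτ : 0 < τ := by positivity
  obtain ⟨f, hf, hf0, hfu⟩ := exists_continuous_approx_inv_sqrt hτ
  let k := cfcₙ f y
  have hk : IsSelfAdjoint k := cfcₙ_predicate _ _
  let h := cfcₙ (fun t : ℝ => f t * t * f t) y
  have hh : IsSelfAdjoint h := cfcₙ_predicate _ _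
  have hkh : k * y * k = h := by
    simp only [h]
    rw [cfcₙ_mul _ _ y, cfcₙ_mul _ _ y, cfcₙ_id' ℝ y]
  have hcomp : ‖y - h * y - y * h + h * y * h‖ ≤ σ ^ 2 := by
    have e : y - h * y - y * h + h * y * h = cfcₙ (fun t : ℝ => t - (f t * t * f t) * t
        - t * (f t * t * f t) + (f t * t * f t) * t * (f t * t * f t)) y := by
      rw [cfcₙ_add _ _ y, cfcₙ_sub _ _ y, cfcₙ_sub _ _ y, cfcₙ_mul _ _ y,
        cfcₙ_mul (fun t : ℝ => t) _ y, cfcₙ_mul _ (fun t : ℝ => f t * t * f t) y,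
        cfcₙ_mul _ (fun t : ℝ => t) y, cfcₙ_id' ℝ y]
    rw [e]
    refine norm_cfcₙ_le fun t ht => ?_
    have ht0 : 0 ≤ t := quasispectrum_nonneg_of_nonneg y hy t ht
    obtain ⟨hu0, hu1, hu2⟩ := hfu t ht0
    set u := f t * t * f t
    rw [show t - u * t - t * u + u * t * u = t * (1 - u) * (1 - u) by ring, Real.norm_eq_abs,
      abs_of_nonneg (by have := sub_nonneg.mpr hu1; positivity)]
    have : 2 * τ = σ ^ 2 := by simp only [τ]; ring
    rw [← this]
    nlinarith [mul_nonneg ht0 (sub_nonneg.mpr hu1)]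
  have hnorm : ‖r - r * h‖ ≤ σ := by
    have e : star (r - r * h) * (r - r * h) = x - h * x - x * h + h * x * h := by
      rw [star_sub, star_mul, hr.star_eq, hh.star_eq, ← hrr]
      noncomm_ring
    have h1 : ‖r - r * h‖ * ‖r - r * h‖ ≤ σ ^ 2 := by
      rw [← CStarRing.norm_star_mul_self, e]
      refine le_trans ?_ hcomp
      refine CStarAlgebra.norm_le_norm_of_nonneg_of_le ?_ (sub_mul_compression_le hxy hh)
      rw [← e]
      exact star_mul_self_nonneg _
    nlinarith [norm_nonneg (r - r * h)]
  refine ⟨r * k, ?_⟩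
  have e : x - r * k * y * star (r * k) = (r - r * h) * r := by
    rw [star_mul, hr.star_eq, hk.star_eq, ← hkh, ← hrr]
    noncomm_ring
  rw [e]
  refine (norm_mul_le_of_le hnorm le_rfl).trans ?_
  have : σ * (‖r‖ + 1) = ε := div_mul_cancel₀ _ (by positivity)
  linarith

lemma le_conjugate_cutPos_add {b : A} (hb : IsSelfAdjoint b) {δ : ℝ} (hδ : 0 ≤ δ) {k : A}
    (hk : IsSelfAdjoint k) :
    k * b * k ≤ k * cutPos b δ * k + δ • (k * k) := by
  let m := cfcₙ (fun t : ℝ => max 0 (min t δ)) b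
  have hm0 : max 0 (min 0 δ) = 0 := by simp [hδ]
  have hc0 : max (0 - δ) 0 = 0 := by simp [hδ]
  have hbm : b ≤ cutPos b δ + m := by
    simp only [m, cutPos]
    rw [← cfcₙ_add _ _ b]
    conv_lhs => rw [← cfcₙ_id' ℝ b]
    refine cfcₙ_mono fun t _ => ?_
    rcases le_total t δ with h | h
    · rw [min_eq_left h]
      linarith [le_max_right (t - δ) 0, le_max_right 0 t]
    · rw [min_eq_right h]
      linarith [le_max_left (t - δ) 0, le_max_right 0 δ]
  have hm : ‖m‖ ≤ δ := norm_cfcₙ_le fun t _ => by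
    rw [Real.norm_eq_abs, abs_of_nonneg (le_max_left _ _)]
    exact max_le hδ (min_le_right _ _)
  have h1 := star_left_conjugate_le_conjugate hbm k
  have h2 := CStarAlgebra.star_left_conjugate_le_norm_smul (a := k) (b := m) (cfcₙ_predicate _ _)
  have h3 : ‖m‖ • (star k * k) ≤ δ • (star k * k) :=
    smul_le_smul_of_nonneg_right hm (star_mul_self_nonneg k)
  rw [hk.star_eq] at h1 h2 h3
  calc k * b * k ≤ k * (cutPos b δ + m) * k := h1
    _ = k * cutPos b δ * k + k * m * k := by noncomm_ring
    _ ≤ _ := by gcongr; exact h2.trans h3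

lemma cuntzSubeq_cutPos {a b : A} (ha : IsSelfAdjoint a) (hb : IsSelfAdjoint b) {ε δ : ℝ}
    (hδ : 0 ≤ δ) (hab : ‖a - b‖ ≤ ε - δ) : CuntzSubeq (cutPos a ε) (cutPos b δ) := by
  have hε : 0 ≤ ε := by linarith [norm_nonneg (a - b)]
  rw [cuntzSubeq_iff_forall_exists]
  intro η hη
  let τ := η / 4
  have hτ : 0 < τ := by positivity
  obtain ⟨m, hmdef⟩ : ∃ m : ℝ → ℝ, m = fun t => max (t - ε) 0 := ⟨_, rfl⟩
  have hcut : cutPos a ε = cfcₙ m a := by rw [hmdef, cutPos]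
  have hm : Continuous m := by rw [hmdef]; fun_prop
  have hm_nonneg (t : ℝ) : 0 ≤ m t := by rw [hmdef]; exact le_max_right _ _
  have hm_low (t : ℝ) (h : t ≤ ε) : m t = 0 := by rw [hmdef]; exact max_eq_right (by linarith)
  have hm_high (t : ℝ) (h : ε ≤ t) : m t = t - ε := by
    rw [hmdef]; exact max_eq_left (by linarith)
  have hm0 : m 0 = 0 := hm_low 0 hε
  obtain ⟨f, hf, hf0, hf_low, hfm⟩ : ∃ f : ℝ → ℝ, Continuous f ∧ f 0 = 0 ∧
      (∀ t ≤ ε, f t = 0) ∧ ∀ t, |m t - f t * m t * f t| ≤ 2 * τ := by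
    obtain ⟨g, hg, hg0, hgu⟩ := exists_continuous_approx_inv_sqrt hτ
    refine ⟨fun t => √(m t) * g (m t), (Real.continuous_sqrt.comp hm).mul (hg.comp hm),
      by simp [hm0], fun t h => by simp [hm_low t h], fun t => ?_⟩
    obtain ⟨-, h1, h2⟩ := hgu (m t) (hm_nonneg t)
    have e : m t - √(m t) * g (m t) * m t * (√(m t) * g (m t))
        = m t * (1 - g (m t) * m t * g (m t)) := by
      linear_combination -(g (m t) * m t * g (m t)) * Real.mul_self_sqrt (hm_nonneg t)
    rwa [e, abs_of_nonneg (mul_nonneg (hm_nonneg t) (sub_nonneg.mpr h1))]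
  let k := cfcₙ f a
  have hk : IsSelfAdjoint k := cfcₙ_predicate _ _
  have hc : k * cutPos a ε * k = k * a * k - ε • (k * k) := by
    have e1 : k * cutPos a ε * k = cfcₙ (fun t => f t * m t * f t) a := by
      rw [hcut, cfcₙ_mul _ _ a, cfcₙ_mul _ _ a]
    have e2 : k * a * k - ε • (k * k) = cfcₙ (fun t => f t * t * f t - ε * (f t * f t)) a := by
      rw [cfcₙ_sub _ _ a, cfcₙ_mul _ _ a, cfcₙ_mul _ _ a, cfcₙ_const_mul _ _ a,
        cfcₙ_mul _ _ a, cfcₙ_id' ℝ a]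
    rw [e1, e2]
    congr 1
    ext t
    rcases le_total t ε with h | h
    · simp [hf_low t h]
    · rw [hm_high t h]
      ring
  have hnear : ‖cutPos a ε - k * cutPos a ε * k‖ ≤ η / 2 := by
    have e : cutPos a ε - k * cutPos a ε * k = cfcₙ (fun t => m t - f t * m t * f t) a := by
      rw [hcut, cfcₙ_sub _ _ a, cfcₙ_mul _ _ a, cfcₙ_mul _ _ a]
    rw [e]
    exact norm_cfcₙ_le fun t _ => (hfm t).trans_eq (by simp only [τ]; ring)
  have hle : k * cutPos a ε * k ≤ k * cutPos b δ * k := by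
    have h1 := CStarAlgebra.star_left_conjugate_le_norm_smul (a := k) (b := a - b) (ha.sub hb)
    have h2 : ‖a - b‖ • (star k * k) ≤ (ε - δ) • (star k * k) :=
      smul_le_smul_of_nonneg_right hab (star_mul_self_nonneg k)
    rw [hk.star_eq] at h1 h2
    rw [hc, sub_le_iff_le_add]
    calc k * a * k = k * (a - b) * k + k * b * k := by noncomm_ring
      _ ≤ (ε - δ) • (k * k) + (k * cutPos b δ * k + δ • (k * k)) :=
        add_le_add (h1.trans h2) (le_conjugate_cutPos_add hb hδ hk)
      _ = k * cutPos b δ * k + ε • (k * k) := by module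
  have hpos : 0 ≤ k * cutPos a ε * k := by
    have : 0 ≤ cutPos a ε := cfcₙ_nonneg fun t _ => le_max_right _ _
    simpa [hk.star_eq] using star_left_conjugate_nonneg this k
  obtain ⟨v, hv⟩ := cuntzSubeq_iff_forall_exists.mp (cuntzSubeq_of_le hpos hle) (η / 2)
    (by positivity)
  refine ⟨v * k, ?_⟩
  have e : cutPos a ε - v * k * cutPos b δ * star (v * k)
      = (cutPos a ε - k * cutPos a ε * k)
        + (k * cutPos a ε * k - v * (k * cutPos b δ * k) * star v) := by
    rw [star_mul, hk.star_eq]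
    noncomm_ring
  rw [e]
  exact (norm_add_le _ _).trans (by linarith)

end Cuntz

/-- Remark 2.3: replacing the mutually orthogonal projections in the definition of the tracial
Rokhlin property by almost orthogonal self-adjoint almost projections yields an equivalent
definition. -/
theorem tracialRokhlin_iff_almost_projections
    {A : Type*} [NonUnitalCStarAlgebra A] [PartialOrder A] [StarOrderedRing A]
    {G : Type*} [Group G] [Fintype G]
    (hA : IsSimpleCStarAlgebra A)
    (α : G → A ≃⋆ₐ[ℂ] A) (hα : ∀ g h : G, ∀ a : A, α (g * h) a = α g (α h a)) :
    (∀ (F : Finset A) (ε : ℝ), 0 < ε → ∀ x y : A, 0 ≤ x → 0 ≤ y → ‖x‖ = 1 →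
      ∃ p : G → A,
        (∀ g, IsSelfAdjoint (p g)) ∧
        (∀ g, ‖p g * p g - p g‖ < ε) ∧
        (∀ g h, g ≠ h → ‖p g * p h‖ < ε) ∧
        (∀ a ∈ F, ∀ g, ‖p g * a - a * p g‖ < ε) ∧
        (∀ g h, ‖α g (p h) - p (g * h)‖ < ε) ∧
        CuntzSubeq (cutPos (y * y - y * (∑ g, p g) * y) ε) x ∧
        ‖(∑ g, p g) * x * (∑ g, p g)‖ > 1 - ε) ↔
    TracialRokhlinProperty α := by

  constructor
  · intro H F ε hε x y hx hy hx1
    let n : ℝ := Fintype.card G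
    let M := ∑ a ∈ F, ‖a‖
    have hn : 0 ≤ n := Nat.cast_nonneg _
    have hM : 0 ≤ M := Finset.sum_nonneg fun _ _ => norm_nonneg _
    let K := 2 * M + 2 + 3 * n + n * ‖y‖ ^ 2
    have hK : 0 < K := by positivity
    let η := min ε 1 / (2 * K)
    have hη : 0 < η := by positivity
    have hηK : η * (2 * K) = min ε 1 := div_mul_cancel₀ _ (by positivity)
    have hηε : η * (2 * M + 2 + 3 * n + n * ‖y‖ ^ 2) ≤ ε / 2 := by
      linarith [hηK.trans_le (min_le_left _ _)]
    have hη1 : η * (2 * M + 2 + 3 * n + n * ‖y‖ ^ 2) ≤ 1 / 2 := by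
      linarith [hηK.trans_le (min_le_right _ _)]
    have hηM : 0 ≤ η * M := by positivity
    have hηn : 0 ≤ η * n := by positivity
    have hηy : 0 ≤ η * (n * ‖y‖ ^ 2) := by positivity
    obtain ⟨δ, hδ, near⟩ := exists_orthogonal_projections_near A (Finset.univ : Finset G) hη
    have hδ' : 0 < min δ (ε / 2) := by positivity
    obtain ⟨q, hq, hqq, hqo, hqF, hqα, hqy, hqx⟩ := H F (min δ (ε / 2)) hδ' x y hx hy hx1
    have hδε : min δ (ε / 2) ≤ ε / 2 := min_le_right _ _
    obtain ⟨p, hp, hpq, hpo⟩ := near q hq (fun g => (hqq g).le.trans (min_le_left _ _))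
      fun g h hgh => (hqo g h hgh).le.trans (min_le_left _ _)
    simp only [Finset.mem_univ, forall_const] at hp hpq hpo
    let P := ∑ g, p g
    let Q := ∑ g, q g
    have hP : IsProjection P := IsProjection.sum (fun g _ => hp g) fun g _ h _ => hpo g h
    have hQ : IsSelfAdjoint Q := isSelfAdjoint_sum _ fun g _ => hq g
    have hPQ : ‖P - Q‖ ≤ η * n := by
      simp only [P, Q]
      rw [← Finset.sum_sub_distrib]
      refine (norm_sum_le_of_le _ fun g _ => hpq g).trans ?_
      simp [n, mul_comm]
    refine ⟨p, hp, hpo, fun a ha g => ?_, fun g h => ?_, ?_, ?_⟩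
    · have haM : ‖a‖ ≤ M := Finset.single_le_sum (fun b _ => norm_nonneg b) ha
      have e : p g * a - a * p g
          = (q g * a - a * q g) + ((p g - q g) * a - a * (p g - q g)) := by noncomm_ring
      have h1 : ‖(p g - q g) * a‖ ≤ η * M := norm_mul_le_of_le (hpq g) haM
      have h2 : ‖a * (p g - q g)‖ ≤ M * η := norm_mul_le_of_le haM (hpq g)
      have h3 := norm_add_le (q g * a - a * q g) ((p g - q g) * a - a * (p g - q g))
      have h4 := norm_sub_le ((p g - q g) * a) (a * (p g - q g))
      rw [e]
      linarith [hqF a ha g]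
    · have e : α g (p h) - p (g * h)
          = (α g (q h) - q (g * h)) + (α g (p h - q h) - (p (g * h) - q (g * h))) := by
        rw [map_sub]
        abel
      have h1 : ‖α g (p h - q h)‖ ≤ η :=
        (NonUnitalStarAlgHom.norm_map (α g) (α g).injective _).trans_le (hpq h)
      have h2 := norm_add_le (α g (q h) - q (g * h)) (α g (p h - q h) - (p (g * h) - q (g * h)))
      have h3 := norm_sub_le (α g (p h - q h)) (p (g * h) - q (g * h))
      rw [e]
      linarith [hqα g h, hpq (g * h)]
    · have hys : IsSelfAdjoint y := hy.isSelfAdjoint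
      have sa {z : A} (hz : IsSelfAdjoint z) : IsSelfAdjoint (y * y - y * z * y) := by
        simp [IsSelfAdjoint, hys.star_eq, hz.star_eq, mul_assoc]
      refine (cuntzSubeq_cutPos (sa hP.1) (sa hQ) hδ'.le ?_).trans hqy
      have e : (y * y - y * P * y) - (y * y - y * Q * y) = -(y * (P - Q) * y) := by noncomm_ring
      rw [e, norm_neg]
      have : ‖y * (P - Q) * y‖ ≤ ‖y‖ * (η * n) * ‖y‖ :=
        norm_mul_le_of_le (norm_mul_le_of_le le_rfl hPQ) le_rfl
      linarith
    · change ‖P * x * P‖ > 1 - ε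
      have hP1 := hP.norm_le_one
      have hQ2 : ‖Q‖ ≤ 2 := by
        have : ‖Q‖ ≤ ‖P‖ + ‖P - Q‖ := by simpa using norm_sub_le P (P - Q)
        linarith
      have e : Q * x * Q = P * x * P - ((P - Q) * x * P + Q * x * (P - Q)) := by noncomm_ring
      have h1 : ‖(P - Q) * x * P‖ ≤ η * n * 1 * 1 :=
        norm_mul_le_of_le (norm_mul_le_of_le hPQ hx1.le) hP1
      have h2 : ‖Q * x * (P - Q)‖ ≤ 2 * 1 * (η * n) :=
        norm_mul_le_of_le (norm_mul_le_of_le hQ2 hx1.le) hPQ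
      have h3 := norm_sub_le (P * x * P) ((P - Q) * x * P + Q * x * (P - Q))
      have h4 := norm_add_le ((P - Q) * x * P) (Q * x * (P - Q))
      change ‖Q * x * Q‖ > _ at hqx
      rw [e] at hqx
      linarith
  · intro H F ε hε x y hx hy hx1
    obtain ⟨p, hp, hpo, hF, hα', hy', hx'⟩ := H F ε hε x y hx hy hx1
    exact ⟨p, fun g => (hp g).1, fun g => by simpa [(hp g).2] using hε,
      fun g h hgh => by simpa [hpo g h hgh] using hε, hF, hα', hy', hx'⟩
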